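/- arXiv:2405.08561 — 2 statements merged into one kernel-verified Lean document; each statement's English description precedes it below -/
import Mathlib

section
/- Let K be a monotone kernel function, n ∈ ℕ, r₁,…,rₙ > 0 with R := r₁ + … + rₙ, and let J be an n-field function on ℝ that is R-admissible for K. Then M(S^∞) = m(S^∞), i.e., inf_{y∈S^∞} max_{0≤j≤n} mⱼ(y) = sup_{y∈S^∞} min_{0≤j≤n} mⱼ(y). -/
open Filter Set Topology

noncomputable section

/-- A kernel function: finite on `ℝ \ {0}`, concave on `(-∞,0)` and `(0,∞)`,
with equal one-sided limits at `0`, equal to `K 0` (real or `⊥`). -/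
def IsKernel (K : ℝ → EReal) : Prop :=
  (∀ t : ℝ, t ≠ 0 → K t ≠ ⊥ ∧ K t ≠ ⊤) ∧
  ConcaveOn ℝ (Iio (0:ℝ)) (fun t => (K t).toReal) ∧
  ConcaveOn ℝ (Ioi (0:ℝ)) (fun t => (K t).toReal) ∧
  K 0 ≠ ⊤ ∧
  Tendsto K (𝓝[<] (0:ℝ)) (𝓝 (K 0)) ∧
  Tendsto K (𝓝[>] (0:ℝ)) (𝓝 (K 0))

/-- A monotone kernel: nonincreasing on `(-∞,0)`, nondecreasing on `(0,∞)`. -/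
def MonotoneKernel (K : ℝ → EReal) : Prop :=
  IsKernel K ∧ AntitoneOn K (Iio (0:ℝ)) ∧ MonotoneOn K (Ioi (0:ℝ))

/-- An `n`-field function on `ℝ`: bounded above, finite at more than `n` points. -/
def IsFieldFn (n : ℕ) (J : ℝ → EReal) : Prop :=
  (∃ c : ℝ, ∀ t, J t ≤ (c : EReal)) ∧
  (∃ S : Finset ℝ, n < S.card ∧ ∀ x ∈ S, J x ≠ ⊥)

/-- `J` is `R`-admissible for `K`: `J(t) + R·K(t) → -∞` as `|t| → ∞`. -/
def IsAdmissible (K J : ℝ → EReal) (R : ℝ) : Prop :=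
  Tendsto (fun t => J t + (R : EReal) * K t) (cocompact ℝ) (𝓝 ⊥)

/-- The sum of translates function `F(y,t) = J(t) + ∑ rⱼ K(t - yⱼ)`. -/
def SumTrans (K J : ℝ → EReal) {n : ℕ} (r y : Fin n → ℝ) (t : ℝ) : EReal :=
  J t + ∑ j, (r j : EReal) * K (t - y j)

/-- For monotone `y`, `cell y j` is `[y_j, y_{j+1}]` (with `y_0 = -∞`, `y_{n+1} = ∞`). -/
def cell {n : ℕ} (y : Fin n → ℝ) (j : Fin (n+1)) : Set ℝ :=
  {t | (∀ i : Fin n, (i : ℕ) < (j : ℕ) → y i ≤ t) ∧ (∀ i : Fin n, (j : ℕ) ≤ (i : ℕ) → t ≤ y i)}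

/-- The local maximum `mⱼ(y)` over the `j`-th cell. -/
def mloc (K J : ℝ → EReal) {n : ℕ} (r y : Fin n → ℝ) (j : Fin (n+1)) : EReal :=
  sSup (SumTrans K J r y '' cell y j)

/-- The local maximum `mⱼ^b(y)` over the `j`-th cell intersected with `[-b,b]`. -/
def mlocSeg (K J : ℝ → EReal) {n : ℕ} (r y : Fin n → ℝ) (b : ℝ) (j : Fin (n+1)) : EReal :=
  sSup (SumTrans K J r y '' (cell y j ∩ Icc (-b) b))

/-- `q` has the Mhaskar–Rakhmanov–Saff property for `(K, J, R)` (with `n` nodes). -/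
def HasMRS (K J : ℝ → EReal) (R : ℝ) (n : ℕ) (q : ℝ) : Prop :=
  ∀ r : Fin n → ℝ, (∀ j, 0 < r j) → (∑ j, r j) ≤ R →
    ∀ y : Fin n → ℝ, Monotone y →
      sSup (range (SumTrans K J r y)) = sSup (SumTrans K J r y '' Icc (-q) q)

namespace MonotoneKernel

variable {K : ℝ → EReal}

lemma coe_toReal (hK : MonotoneKernel K) {t : ℝ} (ht : t ≠ 0) : ((K t).toReal : EReal) = K t :=
  EReal.coe_toReal (hK.1.1 t ht).2 (hK.1.1 t ht).1

lemma ne_top (hK : MonotoneKernel K) (t : ℝ) : K t ≠ ⊤ := by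
  rcases eq_or_ne t 0 with rfl | ht
  · exact hK.1.2.2.2.1
  · exact (hK.1.1 t ht).2

/-- The reflection of a monotone kernel is a monotone kernel. -/
lemma reflect (hK : MonotoneKernel K) : MonotoneKernel (fun t => K (-t)) := by
  obtain ⟨⟨h1, h2, h3, h4, h5, h6⟩, h7, h8⟩ := hK
  refine ⟨⟨fun t ht => h1 (-t) (neg_ne_zero.2 ht), ?_, ?_, by simpa using h4, ?_, ?_⟩, ?_, ?_⟩
  · refine ⟨convex_Iio 0, fun x hx y hy a b ha hb hab => ?_⟩
    have := h3.2 (mem_Ioi.2 (neg_pos.2 (mem_Iio.1 hx)))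
      (mem_Ioi.2 (neg_pos.2 (mem_Iio.1 hy))) ha hb hab
    have e : -(a • x + b • y) = a • -x + b • -y := by simp only [smul_eq_mul]; ring
    simpa only [e] using this
  · refine ⟨convex_Ioi 0, fun x hx y hy a b ha hb hab => ?_⟩
    have := h2.2 (mem_Iio.2 (neg_lt_zero.2 (mem_Ioi.1 hx))) (mem_Iio.2 (neg_lt_zero.2 (mem_Ioi.1 hy)))
      ha hb hab
    have e : -(a • x + b • y) = a • -x + b • -y := by simp only [smul_eq_mul]; ring
    simpa only [e] using this
  · simp only [neg_zero]
    refine h6.comp (tendsto_nhdsWithin_iff.2 ⟨?_, ?_⟩)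
    · simpa using (continuous_neg.tendsto (0 : ℝ)).mono_left nhdsWithin_le_nhds
    · filter_upwards [self_mem_nhdsWithin] with t ht using mem_Ioi.2 (neg_pos.2 (mem_Iio.1 ht))
  · simp only [neg_zero]
    refine h5.comp (tendsto_nhdsWithin_iff.2 ⟨?_, ?_⟩)
    · simpa using (continuous_neg.tendsto (0 : ℝ)).mono_left nhdsWithin_le_nhds
    · filter_upwards [self_mem_nhdsWithin] with t ht using mem_Iio.2 (neg_lt_zero.2 (mem_Ioi.1 ht))
  · exact fun x hx y hy hxy => h8 (mem_Ioi.2 (neg_pos.2 hy)) (mem_Ioi.2 (neg_pos.2 hx))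
      (neg_le_neg hxy)
  · exact fun x hx y hy hxy => h7 (mem_Iio.2 (neg_lt_zero.2 hy)) (mem_Iio.2 (neg_lt_zero.2 hx))
      (neg_le_neg hxy)

lemma mono (hK : MonotoneKernel K) {a b : ℝ} (ha : 0 ≤ a) (hab : a ≤ b) : K a ≤ K b := by
  rcases ha.eq_or_lt with rfl | ha
  · rcases hab.eq_or_lt with rfl | hb
    · exact le_rfl
    · refine le_of_tendsto hK.1.2.2.2.2.2 ?_
      filter_upwards [Ioo_mem_nhdsGT hb] with s hs using hK.2.2 hs.1 hb hs.2.le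
  · exact hK.2.2 ha (ha.trans_le hab) hab

lemma anti (hK : MonotoneKernel K) {a b : ℝ} (hb : b ≤ 0) (hab : a ≤ b) : K b ≤ K a := by
  simpa using hK.reflect.mono (neg_nonneg.2 hb) (neg_le_neg hab)

lemma continuousOn_Ioi (hK : MonotoneKernel K) : ContinuousOn K (Ioi 0) := by
  have h := hK.1.2.2.1.continuousOn isOpen_Ioi
  refine (continuous_coe_real_ereal.comp_continuousOn h).congr fun t ht => ?_
  exact (hK.coe_toReal (ne_of_gt ht)).symm

lemma continuous (hK : MonotoneKernel K) : Continuous K := by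
  refine continuous_iff_continuousAt.2 fun t => ?_
  rcases lt_trichotomy t 0 with ht | rfl | ht
  · have := (hK.reflect.continuousOn_Ioi.continuousAt (Ioi_mem_nhds (neg_pos.2 ht))).comp_of_eq
      (f := fun t : ℝ => -t) continuous_neg.continuousAt rfl
    simpa [Function.comp_def] using this
  · rw [continuousAt_iff_punctured_nhds, ← Iio_union_Ioi, nhdsWithin_union]
    exact hK.1.2.2.2.2.1.sup hK.1.2.2.2.2.2
  · exact hK.continuousOn_Ioi.continuousAt (Ioi_mem_nhds ht)

/-- Among two pairs of positive numbers with the same sum,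
the one with the smaller spread has the larger sum of kernel values. -/
lemma add_le_add_real (hK : MonotoneKernel K) {a b c d : ℝ} (ha : 0 < a) (hab : a ≤ b)
    (hac : a ≤ c) (h : a + d = b + c) :
    (K a).toReal + (K d).toReal ≤ (K b).toReal + (K c).toReal := by
  rcases hab.eq_or_lt with rfl | hab
  · have : d = c := by linarith
    rw [this]
  have hd : 0 < d := by linarith
  have hda : 0 < d - a := by linarith
  have hconc := hK.1.2.2.1.2
  have h1 := hconc (mem_Ioi.2 ha) (mem_Ioi.2 hd) (a := (d - b) / (d - a)) (b := (b - a) / (d - a))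
    (div_nonneg (by linarith) hda.le) (div_nonneg (by linarith) hda.le) (by field_simp; ring)
  have h2 := hconc (mem_Ioi.2 ha) (mem_Ioi.2 hd) (a := (b - a) / (d - a)) (b := (d - b) / (d - a))
    (div_nonneg (by linarith) hda.le) (div_nonneg (by linarith) hda.le) (by field_simp; ring)
  have e1 : ((d - b) / (d - a)) • a + ((b - a) / (d - a)) • d = b := by
    simp only [smul_eq_mul]; field_simp; ring
  have e2 : ((b - a) / (d - a)) • a + ((d - b) / (d - a)) • d = c := by
    obtain rfl : c = a + d - b := by linarith
    simp only [smul_eq_mul]; field_simp; ring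
  rw [e1] at h1
  rw [e2] at h2
  simp only [smul_eq_mul] at h1 h2
  have e3 : (b - a) / (d - a) = 1 - (d - b) / (d - a) := by field_simp; ring
  rw [e3] at h1 h2
  linarith

lemma add_le_add_of_nonneg (hK : MonotoneKernel K) {a b c d : ℝ} (ha : 0 ≤ a) (hab : a ≤ b)
    (hac : a ≤ c) (h : a + d = b + c) : K a + K d ≤ K b + K c := by
  have key : ∀ p q : ℝ, Tendsto (fun e : ℝ => K (p + e) + K (q + e)) (𝓝[>] 0)
      (𝓝 (K p + K q)) := by
    intro p q
    have hp (p : ℝ) : Tendsto (fun e : ℝ => K (p + e)) (𝓝[>] 0) (𝓝 (K p)) := by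
      have : Continuous fun e : ℝ => K (p + e) := hK.continuous.comp (by fun_prop)
      simpa using (this.tendsto 0).mono_left nhdsWithin_le_nhds
    exact (EReal.continuousAt_add (p := (K p, K q)) (.inl (hK.ne_top p)) (.inr (hK.ne_top q))).tendsto.comp
      ((hp p).prodMk_nhds (hp q))
  refine le_of_tendsto_of_tendsto (key a d) (key b c) ?_
  filter_upwards [self_mem_nhdsWithin] with e he
  have he : 0 < e := he
  rw [← hK.coe_toReal (t := a + e) (by linarith), ← hK.coe_toReal (t := b + e) (by linarith),
    ← hK.coe_toReal (t := c + e) (by linarith), ← hK.coe_toReal (t := d + e) (by linarith)]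
  exact_mod_cast hK.add_le_add_real (by linarith) (by linarith) (by linarith) (by linarith)

lemma add_le_add_of_nonpos (hK : MonotoneKernel K) {a b c d : ℝ} (hd : d ≤ 0) (hbd : b ≤ d)
    (hcd : c ≤ d) (h : a + d = b + c) : K a + K d ≤ K b + K c := by
  have := hK.reflect.add_le_add_of_nonneg (a := -d) (b := -b) (c := -c) (d := -a)
    (by linarith) (by linarith) (by linarith) (by linarith)
  simpa [add_comm] using this

end MonotoneKernel

/-- A concave nondecreasing function on the positive half-line has a nonnegative, nonincreasing
choice of supergradients. -/
lemma ConcaveOn.exists_antitone_supergradient {f : ℝ → ℝ} (hf : ConcaveOn ℝ (Ioi 0) f)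
    (hm : MonotoneOn f (Ioi 0)) :
    ∃ g : ℝ → ℝ, (∀ u > 0, 0 ≤ g u) ∧ (∀ u > 0, ∀ v, u ≤ v → g v ≤ g u) ∧
      ∀ u > 0, ∀ v > 0, f v - f u ≤ g u * (v - u) := by
  set s : ℝ → Set ℝ := fun u => (fun v => (f u - f v) / (u - v)) '' Ioo 0 u with hs
  have hpos : ∀ u > 0, ∀ c ∈ s u, 0 ≤ c := by
    rintro u hu _ ⟨v, hv, rfl⟩
    exact div_nonneg (sub_nonneg.2 (hm hv.1 hu hv.2.le)) (sub_nonneg.2 hv.2.le)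
  have hbdd : ∀ u > 0, BddBelow (s u) := fun u hu => ⟨0, fun c hc => hpos u hu c hc⟩
  have hne : ∀ u > 0, (s u).Nonempty := fun u hu => (nonempty_Ioo.2 hu).image _
  have hslope : ∀ u > 0, ∀ v, u < v → (f v - f u) / (v - u) ≤ sInf (s u) := by
    refine fun u hu v huv => le_csInf (hne u hu) ?_
    rintro _ ⟨w, hw, rfl⟩
    exact hf.slope_anti_adjacent hw.1 (hu.trans huv) hw.2 huv
  refine ⟨fun u => sInf (s u), fun u hu => le_csInf (hne u hu) (hpos u hu), ?_, ?_⟩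
  · intro u hu v huv
    rcases huv.eq_or_lt with rfl | huv
    · exact le_rfl
    · exact (csInf_le (hbdd v (hu.trans huv)) ⟨u, ⟨hu, huv⟩, rfl⟩).trans (hslope u hu v huv)
  · intro u hu v hv
    rcases lt_trichotomy u v with huv | rfl | hvu
    · exact (div_le_iff₀ (sub_pos.2 huv)).1 (hslope u hu v huv)
    · simp
    · have := (le_div_iff₀ (sub_pos.2 hvu)).1 (csInf_le (hbdd u hu) ⟨v, ⟨hv, hvu⟩, rfl⟩)
      simp only at this ⊢
      linarith

lemma mul_le_sum_of_antitone {g E : ℕ → ℝ} {N : ℕ} (hE0 : E 0 = 0) (hE : ∀ k ≤ N, 0 ≤ E k)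
    (hg : ∀ j < N, 0 ≤ g j) (hanti : ∀ i j, i ≤ j → j < N → g j ≤ g i) :
    0 ≤ ∑ j ∈ Finset.range N, g j * (E (j + 1) - E j) := by
  suffices H : ∀ k ≤ N, ∀ c, 0 ≤ c → (∀ j < k, c ≤ g j) →
      c * E k ≤ ∑ j ∈ Finset.range k, g j * (E (j + 1) - E j) by
    simpa using H N le_rfl 0 le_rfl hg
  intro k
  induction k with
  | zero => intro _ c _ _; simp [hE0]
  | succ k ih =>
    intro hk c hc hcg
    have h1 := ih (by omega) (g k) (hg k hk) fun j hj => hanti j k hj.le hk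
    have h2 := mul_le_mul_of_nonneg_right (hcg k k.lt_succ_self) (hE (k + 1) hk)
    rw [Finset.sum_range_succ]
    linarith

/-- A weighted majorization inequality for concave nondecreasing functions. -/
lemma ConcaveOn.sum_le_sum_of_majorized {f : ℝ → ℝ} (hf : ConcaveOn ℝ (Ioi 0) f)
    (hm : MonotoneOn f (Ioi 0)) {a p q : ℕ → ℝ} {N : ℕ} (ha : ∀ j < N, 0 ≤ a j)
    (hp : ∀ j < N, 0 < p j) (hq : ∀ j < N, 0 < q j) (hmono : ∀ i j, i ≤ j → j < N → p i ≤ p j)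
    (hE : ∀ k ≤ N, 0 ≤ ∑ j ∈ Finset.range k, a j * (p j - q j)) :
    ∑ j ∈ Finset.range N, a j * f (q j) ≤ ∑ j ∈ Finset.range N, a j * f (p j) := by
  obtain ⟨g, hg0, hganti, hg⟩ := hf.exists_antitone_supergradient hm
  have h := mul_le_sum_of_antitone (g := fun j => g (p j))
    (E := fun k => ∑ j ∈ Finset.range k, a j * (p j - q j)) (by simp) hE
    (fun j hj => hg0 _ (hp j hj)) (fun i j hij hj => hganti _ (hp i (by omega)) _ (hmono i j hij hj))
  rw [← sub_nonneg, ← Finset.sum_sub_distrib]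
  refine h.trans (Finset.sum_le_sum fun j hj => ?_)
  have hj := Finset.mem_range.1 hj
  have h1 := mul_le_mul_of_nonneg_left (hg _ (hp j hj) _ (hq j hj)) (ha j hj)
  rw [Finset.sum_range_succ]
  linarith

namespace MonotoneKernel

variable {K : ℝ → EReal}

lemma mul_ne_top (hK : MonotoneKernel K) {c : ℝ} (hc : 0 ≤ c) (t : ℝ) : (c : EReal) * K t ≠ ⊤ := by
  rcases hc.eq_or_lt with rfl | hc
  · simp
  have := hK.ne_top t
  induction h : K t with
  | bot => simp [EReal.coe_mul_bot_of_pos hc]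
  | coe x => exact_mod_cast EReal.coe_ne_top (c * x)
  | top => exact absurd h this

lemma continuous_mul (hK : MonotoneKernel K) (c : ℝ) :
    Continuous fun t => (c : EReal) * K t := by
  refine continuous_iff_continuousAt.2 fun t => ?_
  refine EReal.Tendsto.const_mul hK.continuous.continuousAt ?_ ?_ <;>
    simp [EReal.coe_ne_top]

lemma sum_mul_ne_top (hK : MonotoneKernel K) {ι : Type*} (s : Finset ι) {a : ι → ℝ}
    (ha : ∀ j ∈ s, 0 < a j) (p : ι → ℝ) : ∑ j ∈ s, (a j : EReal) * K (p j) ≠ ⊤ := by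
  classical
  induction s using Finset.induction_on with
  | empty => simp
  | insert i s his ih =>
    rw [Finset.sum_insert his]
    exact EReal.add_ne_top (hK.mul_ne_top (ha i (by simp)).le _) (ih fun j hj => ha j (by simp [hj]))

lemma continuous_sum_mul (hK : MonotoneKernel K) {X ι : Type*} [TopologicalSpace X] (s : Finset ι)
    {a : ι → ℝ} (ha : ∀ j ∈ s, 0 < a j) {p : X → ι → ℝ} (hp : ∀ j, Continuous fun x => p x j) :
    Continuous fun x => ∑ j ∈ s, (a j : EReal) * K (p x j) := by
  classical
  induction s using Finset.induction_on with
  | empty => simpa using continuous_const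
  | insert i s his ih =>
    simp only [Finset.sum_insert his]
    refine continuous_iff_continuousAt.2 fun x => ?_
    have h1 := ((hK.continuous_mul (a i)).comp (hp i)).tendsto x
    have h2 := (ih fun j hj => ha j (by simp [hj])).tendsto x
    exact (EReal.continuousAt_add
      (p := ((a i : EReal) * K (p x i), ∑ j ∈ s, (a j : EReal) * K (p x j)))
      (.inl (hK.mul_ne_top (ha i (by simp)).le _))
      (.inr (hK.sum_mul_ne_top s (fun j hj => ha j (by simp [hj])) _))).tendsto.comp
      (h1.prodMk_nhds h2)

lemma sum_mul_eq_coe (hK : MonotoneKernel K) {ι : Type*} (s : Finset ι) {a p : ι → ℝ}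
    (hp : ∀ j ∈ s, p j ≠ 0) :
    ∑ j ∈ s, (a j : EReal) * K (p j) = ((∑ j ∈ s, a j * (K (p j)).toReal : ℝ) : EReal) := by
  classical
  induction s using Finset.induction_on with
  | empty => simp
  | insert i s his ih =>
    rw [Finset.sum_insert his, Finset.sum_insert his, ih fun j hj => hp j (by simp [hj]),
      EReal.coe_add, EReal.coe_mul, hK.coe_toReal (hp i (by simp))]

lemma sum_le_sum_of_majorized (hK : MonotoneKernel K) {a p q : ℕ → ℝ} {N : ℕ}
    (ha : ∀ j < N, 0 < a j) (hp : ∀ j < N, 0 ≤ p j) (hq : ∀ j < N, 0 ≤ q j)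
    (hmono : ∀ i j, i ≤ j → j < N → p i ≤ p j)
    (hE : ∀ k ≤ N, 0 ≤ ∑ j ∈ Finset.range k, a j * (p j - q j)) :
    ∑ j ∈ Finset.range N, (a j : EReal) * K (q j) ≤
      ∑ j ∈ Finset.range N, (a j : EReal) * K (p j) := by
  have key : ∀ p : ℕ → ℝ, Tendsto
      (fun e : ℝ => ∑ j ∈ Finset.range N, (a j : EReal) * K (p j + e)) (𝓝[>] 0)
      (𝓝 (∑ j ∈ Finset.range N, (a j : EReal) * K (p j))) := by
    intro p
    have : Continuous fun e : ℝ => ∑ j ∈ Finset.range N, (a j : EReal) * K (p j + e) :=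
      hK.continuous_sum_mul (p := fun (e : ℝ) j => p j + e) _
        (fun j hj => ha j (Finset.mem_range.1 hj)) (fun j => by fun_prop)
    simpa using (this.tendsto 0).mono_left nhdsWithin_le_nhds
  refine le_of_tendsto_of_tendsto (key q) (key p) ?_
  filter_upwards [self_mem_nhdsWithin] with e he
  have he : 0 < e := he
  have hp' : ∀ j < N, 0 < p j + e := fun j hj => by linarith [hp j hj]
  have hq' : ∀ j < N, 0 < q j + e := fun j hj => by linarith [hq j hj]
  rw [hK.sum_mul_eq_coe _ fun j hj => (hp' j (Finset.mem_range.1 hj)).ne',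
    hK.sum_mul_eq_coe _ fun j hj => (hq' j (Finset.mem_range.1 hj)).ne', EReal.coe_le_coe_iff]
  refine hK.1.2.2.1.sum_le_sum_of_majorized ?_ (fun j hj => (ha j hj).le) hp' hq'
    (fun i j hij hj => by linarith [hmono i j hij hj]) (by simpa using hE)
  intro u hu v hv huv
  exact EReal.toReal_le_toReal (hK.2.2 hu hv huv) (hK.1.1 u (ne_of_gt hu)).1 (hK.ne_top v)

end MonotoneKernel

/-- If the weighted partial sums of `Y - X` are minimal at `i`, then passing from the nodes `X` to
the nodes `Y` raises the sum of translates at every point between the nodes `X (i - 1)` and `X i`,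
and such a point stays between the nodes `Y (i - 1)` and `Y i`. -/
lemma MonotoneKernel.sum_le_sum_of_partialSum_le {K : ℝ → EReal} (hK : MonotoneKernel K)
    {a X Y : ℕ → ℝ} {n i : ℕ} (hin : i ≤ n) (ha : ∀ j < n, 0 < a j)
    (hY : ∀ j k, j ≤ k → k < n → Y j ≤ Y k)
    (hE : ∀ k ≤ n, ∑ j ∈ Finset.range i, a j * (Y j - X j) ≤
      ∑ j ∈ Finset.range k, a j * (Y j - X j))
    {t : ℝ} (hl : ∀ j < i, X j ≤ t) (hr : ∀ j, i ≤ j → j < n → t ≤ X j) :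
    (∀ j < i, Y j ≤ t) ∧ (∀ j, i ≤ j → j < n → t ≤ Y j) ∧
      ∑ j ∈ Finset.range n, (a j : EReal) * K (t - X j) ≤
        ∑ j ∈ Finset.range n, (a j : EReal) * K (t - Y j) := by
  have hYl : ∀ j < i, Y j ≤ t := by
    intro j hj
    obtain ⟨i, rfl⟩ : ∃ m, i = m + 1 := ⟨i - 1, by omega⟩
    have h := hE i (by omega)
    rw [Finset.sum_range_succ] at h
    have h1 : a i * (Y i - X i) ≤ 0 := by linarith
    have h2 := nonpos_of_mul_nonpos_right h1 (ha i hin)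
    linarith [hY j i (by omega) hin, hl i (by omega)]
  have hYr : ∀ j, i ≤ j → j < n → t ≤ Y j := by
    intro j hij hj
    have h := hE (i + 1) (by omega)
    rw [Finset.sum_range_succ] at h
    have h1 : 0 ≤ a i * (Y i - X i) := by linarith
    have h2 := nonneg_of_mul_nonneg_right h1 (ha i (by omega))
    linarith [hY i j hij hj, hr i le_rfl (by omega)]
  refine ⟨hYl, hYr, ?_⟩
  rw [← Finset.sum_range_add_sum_Ico _ hin, ← Finset.sum_range_add_sum_Ico _ hin]
  refine add_le_add ?_ ?_
  · rw [← Finset.sum_range_reflect, ← Finset.sum_range_reflect (fun j => (a j : EReal) * K (t - Y j))]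
    refine hK.sum_le_sum_of_majorized (a := fun j => a (i - 1 - j)) (q := fun j => t - X (i - 1 - j))
      (p := fun j => t - Y (i - 1 - j)) (fun j hj => ha _ (by omega))
      (fun j hj => sub_nonneg.2 (hYl _ (by omega))) (fun j hj => sub_nonneg.2 (hl _ (by omega)))
      (fun j k hjk hk => sub_le_sub_left (hY _ _ (by omega) (by omega)) _) fun k hk => ?_
    have : ∀ k ≤ i, ∑ j ∈ Finset.range k,
        a (i - 1 - j) * (t - Y (i - 1 - j) - (t - X (i - 1 - j))) =
        ∑ j ∈ Finset.range (i - k), a j * (Y j - X j) -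
          ∑ j ∈ Finset.range i, a j * (Y j - X j) := by
      intro k
      induction k with
      | zero => simp
      | succ k ih =>
        intro hk
        rw [Finset.sum_range_succ, ih (by omega), show i - k = i - 1 - k + 1 by omega,
          Finset.sum_range_succ, show i - (k + 1) = i - 1 - k by omega]
        ring
    rw [this k hk]
    linarith [hE (i - k) (by omega)]
  · rw [Finset.sum_Ico_eq_sum_range, Finset.sum_Ico_eq_sum_range]
    have := hK.reflect.sum_le_sum_of_majorized (a := fun j => a (i + j))
      (q := fun j => X (i + j) - t) (p := fun j => Y (i + j) - t) (N := n - i)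
      (fun j hj => ha _ (by omega)) (fun j hj => sub_nonneg.2 (hYr _ (by omega) (by omega)))
      (fun j hj => sub_nonneg.2 (hr _ (by omega) (by omega)))
      (fun j k hjk hk => sub_le_sub_right (hY _ _ (by omega) (by omega)) _) fun k hk => ?_
    · simpa using this
    have h := hE (i + k) (by omega)
    rw [Finset.sum_range_add] at h
    simp only [sub_sub_sub_cancel_right]
    linarith

/-- For any two node systems some cell of the first is contained in the corresponding cell of the
second, with the sum of translates no smaller there. -/
lemma exists_mloc_le_mloc {K : ℝ → EReal} (hK : MonotoneKernel K) (J : ℝ → EReal) {n : ℕ}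
    {r : Fin n → ℝ} (hr : ∀ j, 0 < r j) (x : Fin n → ℝ) {y : Fin n → ℝ} (hy : Monotone y) :
    ∃ i, mloc K J r x i ≤ mloc K J r y i := by
  let e : (Fin n → ℝ) → ℕ → ℝ := fun z j => if h : j < n then z ⟨j, h⟩ else 0
  have he : ∀ z (j : Fin n), e z j = z j := fun z j => dif_pos j.2
  have he' : ∀ z j (h : j < n), e z j = z ⟨j, h⟩ := fun z j h => dif_pos h
  obtain ⟨i, hi⟩ := Finite.exists_min
    fun k : Fin (n + 1) => ∑ j ∈ Finset.range k, e r j * (e y j - e x j)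
  have hsum : ∀ z t, ∑ j, (r j : EReal) * K (t - z j) =
      ∑ j ∈ Finset.range n, (e r j : EReal) * K (t - e z j) := by
    intro z t
    rw [← Fin.sum_univ_eq_sum_range (fun j => (e r j : EReal) * K (t - e z j))]
    simp only [he]
  refine ⟨i, sSup_le ?_⟩
  rintro _ ⟨t, ht, rfl⟩
  obtain ⟨h1, h2, h3⟩ := hK.sum_le_sum_of_partialSum_le (a := e r) (X := e x) (Y := e y)
    (Nat.lt_succ_iff.1 i.2) (fun j hj => by rw [he' _ _ hj]; exact hr _)
    (fun j k hjk hk => by rw [he' _ _ hk, he' _ _ (hjk.trans_lt hk)]; exact hy hjk)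
    (fun k hk => hi ⟨k, Nat.lt_succ_iff.2 hk⟩)
    (fun j hj => by rw [he' _ _ (by omega)]; exact ht.1 _ hj)
    (fun j hij hj => by rw [he' _ _ hj]; exact ht.2 _ hij)
  refine le_trans ?_ (le_sSup (mem_image_of_mem _ (show t ∈ cell y i from
    ⟨fun j hj => by simpa only [he] using h1 j hj, fun j hj => by simpa only [he] using h2 j hj j.2⟩)))
  unfold SumTrans
  rw [hsum, hsum]
  exact add_le_add le_rfl h3

/-- The sum of the translated kernels, without the field. -/
def translateSum (K : ℝ → EReal) {n : ℕ} (r y : Fin n → ℝ) (t : ℝ) : EReal :=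
  ∑ j, (r j : EReal) * K (t - y j)

section TranslateSum

variable {K : ℝ → EReal} {n : ℕ} {r : Fin n → ℝ}

lemma translateSum_ne_top (hK : MonotoneKernel K) (hr : ∀ j, 0 < r j) (y : Fin n → ℝ) (t : ℝ) :
    translateSum K r y t ≠ ⊤ :=
  hK.sum_mul_ne_top _ (fun j _ => hr j) _

lemma continuous_translateSum (hK : MonotoneKernel K) (hr : ∀ j, 0 < r j) :
    Continuous fun p : (Fin n → ℝ) × ℝ => translateSum K r p.1 p.2 :=
  hK.continuous_sum_mul (p := fun (p : (Fin n → ℝ) × ℝ) j => p.2 - p.1 j) _ (fun j _ => hr j)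
    fun j => by fun_prop

lemma translateSum_eq_bot_iff (hr : ∀ j, 0 < r j) {y : Fin n → ℝ} {t : ℝ} :
    translateSum K r y t = ⊥ ↔ ∃ j, K (t - y j) = ⊥ := by
  have h : ∀ s : Finset (Fin n), ∑ j ∈ s, (r j : EReal) * K (t - y j) = ⊥ ↔
      ∃ j ∈ s, K (t - y j) = ⊥ := by
    intro s
    induction s using Finset.induction_on with
    | empty => simp
    | insert i s his ih =>
      have hi : (r i : EReal) * K (t - y i) = ⊥ ↔ K (t - y i) = ⊥ := by
        have h0 : ¬ (r i < 0) := (hr i).le.not_gt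
        simp [EReal.mul_eq_bot, hr i, h0]
      rw [Finset.sum_insert his, EReal.add_eq_bot_iff, ih, hi]
      simp
  simpa [translateSum] using h Finset.univ

/-- Moving nodes to the right (other than those at which a point `s` is separated from a point `t`)
raises the sum of translates at the right point `s` by at least as much as at the left point `t`. -/
lemma translateSum_add_le (hK : MonotoneKernel K) (hr : ∀ j, 0 < r j) {x z : Fin n → ℝ}
    (hxz : x ≤ z) {s t : ℝ} (hts : t ≤ s) (h : ∀ j, x j = z j ∨ z j ≤ t ∨ s ≤ x j) :
    translateSum K r z t + translateSum K r x s ≤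
      translateSum K r z s + translateSum K r x t := by
  unfold translateSum
  rw [← Finset.sum_add_distrib, ← Finset.sum_add_distrib]
  refine Finset.sum_le_sum fun j _ => ?_
  have h0 : (0 : EReal) ≤ r j := by exact_mod_cast (hr j).le
  rw [← EReal.left_distrib_of_nonneg_of_ne_top h0 (EReal.coe_ne_top _),
    ← EReal.left_distrib_of_nonneg_of_ne_top h0 (EReal.coe_ne_top _)]
  refine mul_le_mul_of_nonneg_left ?_ h0
  have hj := hxz j
  rcases h j with h | h | h
  · rw [h, add_comm]
  · exact hK.add_le_add_of_nonneg (by linarith) (by linarith) (by linarith) (by ring)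
  · exact hK.add_le_add_of_nonpos (by linarith) (by linarith) (by linarith) (by ring)

end TranslateSum

section Cell

variable {n : ℕ} {y : Fin n → ℝ} {t : ℝ}

lemma mem_cell_castSucc_iff (hy : Monotone y) {i : Fin n} :
    t ∈ cell y i.castSucc ↔ (∀ j < i, y j ≤ t) ∧ t ≤ y i :=
  ⟨fun h => ⟨fun j hj => h.1 j hj, h.2 i le_rfl⟩,
    fun h => ⟨fun j hj => h.1 j hj, fun _ hj => h.2.trans (hy hj)⟩⟩

lemma mem_cell_succ_iff (hy : Monotone y) {i : Fin n} :
    t ∈ cell y i.succ ↔ y i ≤ t ∧ ∀ j, i < j → t ≤ y j :=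
  ⟨fun h => ⟨h.1 i (by simp), fun j hj => h.2 j (by simpa using hj)⟩,
    fun h => ⟨fun j hj => (hy (show j ≤ i by simpa [Nat.lt_succ_iff] using hj)).trans h.1,
      fun j hj => h.2 j (by simpa using hj)⟩⟩

lemma exists_mem_cell (hy : Monotone y) (t : ℝ) : ∃ i, t ∈ cell y i := by
  classical
  have hex : ∃ k : ℕ, ∀ j : Fin n, k ≤ (j : ℕ) → t ≤ y j := ⟨n, fun j hj => absurd j.2 (by omega)⟩
  have hle : Nat.find hex ≤ n := Nat.find_min' hex fun j hj => absurd j.2 (by omega)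
  refine ⟨⟨Nat.find hex, Nat.lt_succ_iff.2 hle⟩, fun i hi => ?_, Nat.find_spec hex⟩
  have := Nat.find_min hex hi
  push Not at this
  obtain ⟨j, hij, hj⟩ := this
  exact (hy hij).trans hj.le

lemma isClosed_mem_cell (i : Fin (n + 1)) :
    IsClosed {p : (Fin n → ℝ) × ℝ | p.2 ∈ cell p.1 i} := by
  have h : {p : (Fin n → ℝ) × ℝ | p.2 ∈ cell p.1 i} =
      (⋂ (j : Fin n) (_ : (j : ℕ) < (i : ℕ)), {p | p.1 j ≤ p.2}) ∩
        ⋂ (j : Fin n) (_ : (i : ℕ) ≤ (j : ℕ)), {p | p.2 ≤ p.1 j} := by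
    ext p
    simp [cell]
  rw [h]
  exact (isClosed_iInter fun j => isClosed_iInter fun _ =>
    isClosed_le (by fun_prop) (by fun_prop)).inter (isClosed_iInter fun j =>
      isClosed_iInter fun _ => isClosed_le (by fun_prop) (by fun_prop))

end Cell

section Mloc

variable {K J : ℝ → EReal} {n : ℕ} {r : Fin n → ℝ}

lemma sumTrans_le_mloc {y : Fin n → ℝ} {i : Fin (n + 1)} {t : ℝ} (ht : t ∈ cell y i) :
    SumTrans K J r y t ≤ mloc K J r y i :=
  le_sSup (mem_image_of_mem _ ht)

lemma mloc_le_iff {y : Fin n → ℝ} {i : Fin (n + 1)} {c : EReal} :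
    mloc K J r y i ≤ c ↔ ∀ t ∈ cell y i, SumTrans K J r y t ≤ c := by
  simp [mloc, sSup_le_iff]

/-- Raising the nodes other than the `i`-th one preserves the inequality between the two local
maxima adjacent to the `i`-th node. -/
lemma mloc_castSucc_le_mloc_succ_of_le (hK : MonotoneKernel K) (hr : ∀ j, 0 < r j)
    {x z : Fin n → ℝ} (hx : Monotone x) (hz : Monotone z) (hxz : x ≤ z) {i : Fin n}
    (hi : x i = z i) (h : mloc K J r x i.castSucc ≤ mloc K J r x i.succ) :
    mloc K J r z i.castSucc ≤ mloc K J r z i.succ := by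
  rw [mloc_le_iff]
  intro t ht
  rw [mem_cell_castSucc_iff hz] at ht
  have htx : t ∈ cell x i.castSucc :=
    (mem_cell_castSucc_iff hx).2 ⟨fun j hj => (hxz j).trans (ht.1 j hj), hi ▸ ht.2⟩
  by_cases hbot : translateSum K r z t = ⊥
  · change J t + translateSum K r z t ≤ _
    simp [hbot]
  have hbotx : translateSum K r x t ≠ ⊥ := by
    rw [translateSum_eq_bot_iff hr] at hbot
    rw [Ne, translateSum_eq_bot_iff hr]
    rintro ⟨j, hj⟩
    have htj : t = x j := by
      by_contra hne
      exact (hK.1.1 _ (sub_ne_zero.2 hne)).1 hj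
    rw [htj, sub_self] at hj
    rcases lt_or_ge j i with hji | hji
    · exact hbot ⟨j, by rw [show t = z j from le_antisymm (htj ▸ hxz j) (ht.1 j hji), sub_self, hj]⟩
    · exact hbot ⟨i, by
        rw [show t = z i from le_antisymm ht.2 (hi ▸ htj ▸ hx hji), sub_self, hj]⟩
  obtain ⟨a, ha⟩ : ∃ a : ℝ, translateSum K r z t = a :=
    ⟨_, (EReal.coe_toReal (translateSum_ne_top hK hr z t) hbot).symm⟩
  obtain ⟨b, hb⟩ : ∃ b : ℝ, translateSum K r x t = b :=
    ⟨_, (EReal.coe_toReal (translateSum_ne_top hK hr x t) hbotx).symm⟩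
  have hsucc : mloc K J r x i.succ ≤ mloc K J r z i.succ - ((a - b : ℝ) : EReal) := by
    rw [mloc_le_iff]
    intro s hs
    rw [mem_cell_succ_iff hx] at hs
    have hsz : s ∈ cell z i.succ :=
      (mem_cell_succ_iff hz).2 ⟨hi ▸ hs.1, fun j hj => (hs.2 j hj).trans (hxz j)⟩
    have hfour := translateSum_add_le hK hr hxz (s := s) (t := t) (by linarith [ht.2, hs.1])
      fun j => by
        rcases lt_trichotomy j i with hj | rfl | hj
        exacts [.inr (.inl (ht.1 j hj)), .inl hi, .inr (.inr (hs.2 j hj))]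
    rw [ha, hb] at hfour
    have hs' : translateSum K r x s + ((a - b : ℝ) : EReal) ≤ translateSum K r z s := by
      have h1 := translateSum_ne_top hK hr x s
      have h2 := translateSum_ne_top hK hr z s
      induction hu : translateSum K r x s with
      | bot => simp
      | top => exact absurd hu h1
      | coe u =>
        induction hv : translateSum K r z s with
        | top => exact le_top
        | bot => rw [hu, hv] at hfour; simp [← EReal.coe_add] at hfour
        | coe v =>
          rw [hu, hv] at hfour
          norm_cast at hfour ⊢
          linarith
    rw [EReal.le_sub_iff_add_le (.inl (EReal.coe_ne_bot _)) (.inl (EReal.coe_ne_top _))]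
    refine le_trans ?_ (sumTrans_le_mloc hsz)
    change J s + translateSum K r x s + _ ≤ J s + translateSum K r z s
    rw [add_assoc]
    exact add_le_add le_rfl hs'
  have hle := ((sumTrans_le_mloc htx).trans h).trans hsucc
  rw [EReal.le_sub_iff_add_le (.inl (EReal.coe_ne_bot _)) (.inl (EReal.coe_ne_top _))] at hle
  refine le_trans (le_of_eq ?_) hle
  change J t + translateSum K r z t = J t + translateSum K r x t + _
  rw [ha, hb, add_assoc, ← EReal.coe_add, add_sub_cancel]

lemma eventually_mloc_lt_sumTrans (hK : MonotoneKernel K) (hr : ∀ j, 0 < r j)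
    (husc : UpperSemicontinuous J) (htop : ∀ t, J t ≠ ⊤) {b : ℝ} (hb : ∀ t ∉ Icc (-b) b, J t = ⊥)
    {y : Fin n → ℝ} {i : Fin (n + 1)} {t : ℝ} (h : mloc K J r y i < SumTrans K J r y t) :
    ∀ᶠ z in 𝓝 y, mloc K J r z i < SumTrans K J r z t := by
  obtain ⟨c, hc, hct⟩ := exists_between h
  have h1 : ∀ᶠ z in 𝓝 y, c < SumTrans K J r z t := by
    have hG : Tendsto (fun z => translateSum K r z t) (𝓝 y) (𝓝 (translateSum K r y t)) :=
      ((continuous_translateSum hK hr).comp (Continuous.prodMk_left t)).tendsto y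
    have : Tendsto (fun z => SumTrans K J r z t) (𝓝 y) (𝓝 (SumTrans K J r y t)) :=
      (EReal.continuousAt_add (p := (J t, translateSum K r y t)) (.inl (htop t))
        (.inr (translateSum_ne_top hK hr y t))).tendsto.comp (tendsto_const_nhds.prodMk_nhds hG)
    exact this.eventually_const_lt hct
  have h2 : ∀ᶠ z in 𝓝 y, ∀ s ∈ Icc (-b) b, s ∈ cell z i → SumTrans K J r z s < c := by
    refine isCompact_Icc.eventually_forall_of_forall_eventually fun s _ => ?_
    by_cases hs : s ∈ cell y i
    · have hF : UpperSemicontinuousAt (fun p : (Fin n → ℝ) × ℝ => SumTrans K J r p.1 p.2) (y, s) := by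
        refine UpperSemicontinuousAt.add' (f := fun p : (Fin n → ℝ) × ℝ => J p.2)
          (g := fun p : (Fin n → ℝ) × ℝ => translateSum K r p.1 p.2) ?_
          (continuous_translateSum hK hr).continuousAt.upperSemicontinuousAt
          (EReal.continuousAt_add (.inl (htop s)) (.inr (translateSum_ne_top hK hr y s)))
        exact (husc.comp continuous_snd) (y, s)
      filter_upwards [hF c ((sumTrans_le_mloc hs).trans_lt hc)] with p hp _ using hp
    · filter_upwards [(isClosed_mem_cell i).isOpen_compl.mem_nhds
        (show (y, s) ∈ {p : (Fin n → ℝ) × ℝ | p.2 ∈ cell p.1 i}ᶜ from hs)] with p hp hp'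
      exact absurd hp' hp
  filter_upwards [h1, h2] with z hz1 hz2
  refine lt_of_le_of_lt (mloc_le_iff.2 fun s hs => ?_) hz1
  by_cases hsb : s ∈ Icc (-b) b
  · exact (hz2 s hsb hs).le
  · simp [SumTrans, hb s hsb]

end Mloc

section Equioscillation

variable {K φ : ℝ → EReal} {n : ℕ} {r : Fin n → ℝ}

/-- The nodes in `[-b, b]` for which the local maxima are nondecreasing from left to right. -/
def subsolutions (K φ : ℝ → EReal) {n : ℕ} (r : Fin n → ℝ) (b : ℝ) : Set (Fin n → ℝ) :=
  {y | Monotone y ∧ (∀ j, y j ∈ Icc (-b) b) ∧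
    ∀ i : Fin n, mloc K φ r y i.castSucc ≤ mloc K φ r y i.succ}

lemma sup_mem_subsolutions (hK : MonotoneKernel K) (hr : ∀ j, 0 < r j) {b : ℝ} {x y : Fin n → ℝ}
    (hx : x ∈ subsolutions K φ r b) (hy : y ∈ subsolutions K φ r b) :
    x ⊔ y ∈ subsolutions K φ r b := by
  have hmono : Monotone (x ⊔ y) := hx.1.sup hy.1
  refine ⟨hmono, fun j => ⟨(hx.2.1 j).1.trans (le_sup_left (b := y j)),
    sup_le (hx.2.1 j).2 (hy.2.1 j).2⟩, fun i => ?_⟩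
  rcases le_total (x i) (y i) with h | h
  · exact mloc_castSucc_le_mloc_succ_of_le hK hr hy.1 hmono le_sup_right
      (by simp [h]) (hy.2.2 i)
  · exact mloc_castSucc_le_mloc_succ_of_le hK hr hx.1 hmono le_sup_left
      (by simp [h]) (hx.2.2 i)

lemma exists_isGreatest_subsolutions (hK : MonotoneKernel K) (hr : ∀ j, 0 < r j)
    (husc : UpperSemicontinuous φ) (htop : ∀ t, φ t ≠ ⊤) {b : ℝ} (hb0 : 0 ≤ b)
    (hb : ∀ t ∉ Ioo (-b) b, φ t = ⊥) : ∃ w, IsGreatest (subsolutions K φ r b) w := by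
  have hb' : ∀ t ∉ Icc (-b) b, φ t = ⊥ := fun t ht => hb t fun h => ht (Ioo_subset_Icc_self h)
  set B := subsolutions K φ r b
  have hne : B.Nonempty := by
    refine ⟨fun _ => -b, monotone_const, fun j => ⟨le_rfl, by linarith⟩, fun i => ?_⟩
    rw [mloc_le_iff]
    intro t ht
    have : t ∉ Ioo (-b) b := fun h => absurd (ht.2 i le_rfl) (not_le.2 h.1)
    simp [SumTrans, hb t this]
  have hbdd : BddAbove B := ⟨fun _ => b, fun y hy j => (hy.2.1 j).2⟩
  have hlub : IsLUB B (sSup B) := isLUB_csSup hne hbdd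
  refine ⟨sSup B, ?_, hlub.1⟩
  set w := sSup B
  have hex : ∀ Q : (Fin n → ℝ) → Prop, (∀ᶠ y in 𝓝 w, Q y) → ∃ y ∈ B, y ≤ w ∧ Q y := by
    intro Q hQ
    have : Nonempty B := hne.to_subtype
    have : IsDirectedOrder B :=
      ⟨fun x y => ⟨⟨x.1 ⊔ y.1, sup_mem_subsolutions hK hr x.2 y.2⟩,
        (le_sup_left : x.1 ≤ x.1 ⊔ y.1), (le_sup_right : y.1 ≤ x.1 ⊔ y.1)⟩⟩
    have ht : Tendsto (fun y : B => (y : Fin n → ℝ)) atTop (𝓝 w) :=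
      tendsto_atTop_isLUB (fun _ _ h => h) (by simpa using hlub)
    obtain ⟨y, hy⟩ := (ht.eventually hQ).exists
    exact ⟨y, y.2, hlub.1 y.2, hy⟩
  have hmono : Monotone w := by
    intro i j hij
    by_contra! h
    obtain ⟨y, hyB, -, hy⟩ := hex (fun y => y j < y i)
      ((continuous_apply j).tendsto w |>.eventually_lt ((continuous_apply i).tendsto w) h)
    exact (hyB.1 hij).not_gt hy
  refine ⟨hmono, fun j => ⟨?_, ?_⟩, fun i => ?_⟩
  · obtain ⟨y, hy⟩ := hne
    exact (hy.2.1 j).1.trans (hlub.1 hy j)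
  · exact hlub.2 (show (fun _ => b) ∈ upperBounds B from fun y hy j => (hy.2.1 j).2) j
  · rw [mloc_le_iff]
    intro t ht
    rw [mem_cell_castSucc_iff hmono] at ht
    rcases ht.2.eq_or_lt with rfl | hti
    · exact sumTrans_le_mloc ((mem_cell_succ_iff hmono).2 ⟨le_rfl, fun j hj => hmono hj.le⟩)
    by_contra! h
    obtain ⟨y, hyB, hyw, hy1, hy2⟩ := hex _
      ((eventually_mloc_lt_sumTrans hK hr husc htop hb' h).and
        ((continuous_apply i).tendsto w |>.eventually_const_lt hti))
    have hty : t ∈ cell y i.castSucc :=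
      (mem_cell_castSucc_iff hyB.1).2 ⟨fun j hj => (hyw j).trans (ht.1 j hj), hy2.le⟩
    exact ((sumTrans_le_mloc hty).trans (hyB.2.2 i)).not_gt hy1

/-- For a compactly supported upper semicontinuous field, some node system makes all local maxima
equal. -/
lemma exists_forall_mloc_eq (hK : MonotoneKernel K) (hr : ∀ j, 0 < r j)
    (husc : UpperSemicontinuous φ) (htop : ∀ t, φ t ≠ ⊤) {b : ℝ} (hb0 : 0 ≤ b)
    (hb : ∀ t ∉ Ioo (-b) b, φ t = ⊥) :
    ∃ w : Fin n → ℝ, Monotone w ∧ ∀ i, mloc K φ r w i = mloc K φ r w 0 := by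
  have hb' : ∀ t ∉ Icc (-b) b, φ t = ⊥ := fun t ht => hb t fun h => ht (Ioo_subset_Icc_self h)
  obtain ⟨w, ⟨hmono, hbox, hle⟩, hmax⟩ := exists_isGreatest_subsolutions hK hr husc htop hb0 hb
  refine ⟨w, hmono, fun i => ?_⟩
  induction i using Fin.induction with
  | zero => rfl
  | succ i ih =>
    refine le_antisymm ?_ (ih ▸ hle i)
    rw [← ih, mloc_le_iff]
    intro t ht
    rw [mem_cell_succ_iff hmono] at ht
    rcases ht.1.eq_or_lt with rfl | hit
    · exact sumTrans_le_mloc ((mem_cell_castSucc_iff hmono).2 ⟨fun j hj => hmono hj.le, le_rfl⟩)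
    by_cases htb : t ∈ Ioo (-b) b
    swap
    · simp [SumTrans, hb t htb]
    by_contra! h
    have hcont : Tendsto (fun u : ℝ => Function.update w i u) (𝓝[>] (w i)) (𝓝 w) := by
      have : Continuous fun u : ℝ => Function.update w i u := continuous_const.update i continuous_id
      simpa using (this.tendsto (w i)).mono_left nhdsWithin_le_nhds
    obtain ⟨u, hu1, hu2⟩ := ((hcont.eventually
      (eventually_mloc_lt_sumTrans hK hr husc htop hb' h)).and (Ioo_mem_nhdsGT hit)).exists
    set z := Function.update w i u with hz
    have hzi : z i = u := by simp [hz]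
    have hzj : ∀ j ≠ i, z j = w j := fun j hj => by simp [hz, hj]
    have hwz : w ≤ z := by
      intro j
      by_cases hj : j = i
      · rw [hj, hzi]; exact hu2.1.le
      · rw [hzj j hj]
    have hzmono : Monotone z := by
      intro j k hjk
      by_cases hk : k = i
      · by_cases hj : j = i
        · rw [hj, hk]
        · rw [hzj j hj]
          exact (hmono hjk).trans (hwz k)
      · rw [hzj k hk]
        by_cases hj : j = i
        · rw [hj, hzi]
          exact hu2.2.le.trans (ht.2 k (lt_of_le_of_ne (hj ▸ hjk) (Ne.symm hk)))
        · rw [hzj j hj]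
          exact hmono hjk
    have htz : t ∈ cell z i.succ :=
      (mem_cell_succ_iff hzmono).2 ⟨hzi ▸ hu2.2.le, fun j hj => (ht.2 j hj).trans (hwz j)⟩
    have hzB : z ∈ subsolutions K φ r b := by
      refine ⟨hzmono, fun j => ⟨(hbox j).1.trans (hwz j), ?_⟩, fun j => ?_⟩
      · by_cases hj : j = i
        · rw [hj, hzi]; exact (hu2.2.trans htb.2).le
        · rw [hzj j hj]; exact (hbox j).2
      · by_cases hj : j = i
        · rw [hj]
          exact hu1.le.trans (sumTrans_le_mloc htz)
        · exact mloc_castSucc_le_mloc_succ_of_le hK hr hmono hzmono hwz (hzj j hj).symm (hle j)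
    exact (hmax hzB i).not_gt (hzi ▸ hu2.1)

end Equioscillation

section UpperEnvelope

variable {K J : ℝ → EReal} {n : ℕ} {r : Fin n → ℝ} {s : Set ℝ} {t : ℝ}

/-- The upper semicontinuous envelope of `J` restricted to `s` (extended by `⊥`). -/
def upperEnvelope (J : ℝ → EReal) (s : Set ℝ) (t : ℝ) : EReal :=
  limsup J (𝓝[s] t)

lemma upperSemicontinuous_upperEnvelope (J : ℝ → EReal) (s : Set ℝ) :
    UpperSemicontinuous (upperEnvelope J s) := by
  intro t c h
  obtain ⟨d, hd, hdc⟩ := exists_between h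
  have h1 := eventually_nhdsWithin_iff.1 (eventually_lt_of_limsup_lt hd)
  filter_upwards [eventually_eventually_nhds.2 h1] with u hu
  refine lt_of_le_of_lt (limsup_le_of_le (by isBoundedDefault) ?_) hdc
  exact (eventually_nhdsWithin_iff.2 hu).mono fun _ => le_of_lt

lemma upperEnvelope_le {c : EReal} (h : ∀ t, J t ≤ c) : upperEnvelope J s t ≤ c :=
  limsup_le_of_le (by isBoundedDefault) (.of_forall h)

lemma le_upperEnvelope (ht : t ∈ s) : J t ≤ upperEnvelope J s t := by
  by_contra! h
  exact lt_irrefl _ ((eventually_lt_of_limsup_lt h).self_of_nhdsWithin ht)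

lemma upperEnvelope_eq_bot (hs : IsClosed s) (ht : t ∉ s) : upperEnvelope J s t = ⊥ := by
  have : 𝓝[s] t = ⊥ := by
    rwa [← not_neBot, ← mem_closure_iff_nhdsWithin_neBot, hs.closure_eq]
  simp [upperEnvelope, this]

lemma exists_lt_of_lt_add {a b c : EReal} (h : c < a + b) : ∃ a' < a, ∃ b' < b, c < a' + b' := by
  by_contra! h'
  exact (EReal.add_le_of_forall_lt h').not_gt h

/-- Lower bounds for all local maxima with respect to the envelope are attained, up to a
perturbation of the nodes, by the original field. -/
lemma exists_forall_lt_mloc (hK : MonotoneKernel K) (hr : ∀ j, 0 < r j) {w : Fin n → ℝ}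
    (hw : Monotone w) {c : EReal} (h : ∀ i, c < mloc K (upperEnvelope J s) r w i) :
    ∃ z : Fin n → ℝ, Monotone z ∧ ∀ i, c < mloc K J r z i := by
  have hpt : ∀ i, ∃ t ∈ cell w i, ∃ a < upperEnvelope J s t, ∃ b < translateSum K r w t,
      c < a + b := by
    intro i
    obtain ⟨_, ⟨t, ht, rfl⟩, hc⟩ := lt_sSup_iff.1 (h i)
    exact ⟨t, ht, exists_lt_of_lt_add hc⟩
  choose t ht a ha b hb hab using hpt
  have htmono : Monotone t := by
    intro i k hik
    rcases hik.eq_or_lt with rfl | hik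
    · exact le_rfl
    · have hi : (i : ℕ) < n := by omega
      exact ((ht i).2 ⟨i, hi⟩ le_rfl).trans ((ht k).1 ⟨i, hi⟩ hik)
  have hδ : ∀ i, ∃ δ > 0, ∀ p : (Fin n → ℝ) × ℝ, dist p (w, t i) < δ →
      b i < translateSum K r p.1 p.2 := fun i =>
    Metric.eventually_nhds_iff.1
      ((continuous_translateSum hK hr).tendsto (w, t i) |>.eventually_const_lt (hb i))
  choose δ hδ0 hδ using hδ
  obtain ⟨ε, hε, hεδ⟩ : ∃ ε > 0, ∀ i, ε ≤ δ i :=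
    ⟨Finset.univ.inf' Finset.univ_nonempty δ, (Finset.lt_inf'_iff _).2 fun i _ => hδ0 i,
      fun i => Finset.inf'_le _ (Finset.mem_univ i)⟩
  have hu : ∀ i, ∃ u, dist u (t i) < ε ∧ a i < J u := fun i =>
    ((frequently_lt_of_lt_limsup (by isBoundedDefault) (ha i)).and_eventually
      (nhdsWithin_le_nhds (Metric.ball_mem_nhds (t i) hε))).exists.imp fun _ h => h.symm
  choose u hut huJ using hu
  let S : Fin (n + 1) → ℝ := fun j => (Finset.Iic j).sup' ⟨j, by simp⟩ u
  have hSmono : Monotone S := fun i j hij => Finset.sup'_mono _ (Finset.Iic_subset_Iic.2 hij) _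
  have hSu : ∀ j, ∃ k ≤ j, S j = u k := fun j => by
    obtain ⟨k, hk, hk'⟩ := Finset.exists_mem_eq_sup' (s := Finset.Iic j) ⟨j, by simp⟩ u
    exact ⟨k, Finset.mem_Iic.1 hk, hk'⟩
  have hSlt : ∀ j, S j < t j + ε := fun j => by
    obtain ⟨k, hk, hk'⟩ := hSu j
    have := (abs_lt.1 (hut k)).2
    linarith [htmono hk]
  have hltS : ∀ j, t j - ε < S j := fun j => by
    have := (abs_lt.1 (hut j)).1
    have h2 : u j ≤ S j := Finset.le_sup' u (by simp)
    linarith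
  set z : Fin n → ℝ := fun j => max (S j.castSucc) (min (w j) (S j.succ))
  have hzw : dist z w < ε := by
    refine (dist_pi_lt_iff hε).2 fun j => abs_lt.2 ⟨?_, ?_⟩
    · have h1 := (ht j.succ).1 j (by simp)
      have h2 : min (w j) (S j.succ) ≤ z j := le_max_right _ _
      have h3 : w j - ε < min (w j) (S j.succ) :=
        lt_min (by linarith) (by linarith [hltS j.succ])
      linarith
    · have h1 := (ht j.castSucc).2 j le_rfl
      have h2 : z j < w j + ε :=
        max_lt (by linarith [hSlt j.castSucc]) ((min_le_left _ _).trans_lt (by linarith))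
      linarith
  refine ⟨z, fun i j hij => max_le_max (hSmono (by simpa using hij))
    (min_le_min (hw hij) (hSmono (by simpa using hij))), fun i => ?_⟩
  have hmem : S i ∈ cell z i :=
    ⟨fun j hj => max_le (hSmono (Fin.le_def.2 hj.le))
      ((min_le_right _ _).trans (hSmono (Fin.le_def.2 (by simpa using hj)))),
      fun j hj => (hSmono (Fin.le_def.2 hj)).trans (le_max_left _ _)⟩
  refine lt_of_lt_of_le ?_ (sumTrans_le_mloc hmem)
  obtain ⟨k, -, hk⟩ := hSu i
  rw [hk]
  refine (hab k).trans_le (add_le_add (huJ k).le (hδ k (z, u k) ?_).le)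
  exact (max_lt hzw (hut k)).trans_le (hεδ k)

end UpperEnvelope

section Localization

variable {K J : ℝ → EReal} {n : ℕ} {r : Fin n → ℝ}

namespace MonotoneKernel

lemma exists_eventually_atTop_sub_le (hK : MonotoneKernel K) (z : ℝ) {ρ : ℝ} (hρ : 0 < ρ) :
    ∃ C : ℝ, ∀ᶠ t in atTop, ∀ y, ρ ≤ |z - y| → K (t - y) ≤ K (z - y) + (K t + C) := by
  set h := |z| + ρ
  have hh : 0 < h := by positivity
  have hz := abs_le.1 (le_refl |z|)
  obtain ⟨k₁, hk₁⟩ : ∃ k : ℝ, K 1 = k := ⟨_, (hK.coe_toReal one_ne_zero).symm⟩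
  obtain ⟨k₂, hk₂⟩ : ∃ k : ℝ, K (1 + h) = k := ⟨_, (hK.coe_toReal (by positivity)).symm⟩
  obtain ⟨k₃, hk₃⟩ : ∃ k : ℝ, K ρ = k := ⟨_, (hK.coe_toReal hρ.ne').symm⟩
  obtain ⟨k₄, hk₄⟩ : ∃ k : ℝ, K (-ρ) = k := ⟨_, (hK.coe_toReal (neg_ne_zero.2 hρ.ne')).symm⟩
  refine ⟨|k₁| + |k₂| + |k₃| + |k₄|, ?_⟩
  filter_upwards [eventually_ge_atTop (1 + h)] with t ht y hy
  have hzy : z - y ≠ 0 := fun h0 => by rw [h0, abs_zero] at hy; linarith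
  obtain ⟨k, hk⟩ : ∃ k : ℝ, K t = k :=
    ⟨_, (hK.coe_toReal (by linarith : 0 < t).ne').symm⟩
  obtain ⟨q, hq⟩ : ∃ q : ℝ, K (z - y) = q := ⟨_, (hK.coe_toReal hzy).symm⟩
  obtain ⟨k', hk'⟩ : ∃ k : ℝ, K (t + h) = k :=
    ⟨_, (hK.coe_toReal (by linarith : 0 < t + h).ne').symm⟩
  have h1 : k₁ + k' ≤ k + k₂ := by
    have := hK.add_le_add_of_nonneg (a := 1) (b := t) (c := 1 + h) (d := t + h)
      zero_le_one (by linarith) (by linarith) (by ring)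
    rw [hk₁, hk', hk, hk₂] at this
    exact_mod_cast this
  have habs₁ := neg_abs_le k₁
  have habs₁' := le_abs_self k₁
  have habs₂ := le_abs_self k₂
  have habs₂' := abs_nonneg k₂
  have habs₃ := neg_abs_le k₃
  have habs₃' := abs_nonneg k₃
  have habs₄ := neg_abs_le k₄
  have habs₄' := abs_nonneg k₄
  rw [hq, hk]
  induction hu : K (t - y) with
  | bot => exact bot_le
  | top => exact absurd hu (hK.ne_top _)
  | coe u =>
    norm_cast
    rcases le_abs'.1 hy with hy | hy
    · rcases le_or_gt y t with hyt | hyt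
      · have h2 : u ≤ k' := by
          have := hK.mono (a := t - y) (b := t + h) (by linarith) (by linarith)
          rw [hu, hk'] at this
          exact_mod_cast this
        have h3 : k₄ ≤ q := by
          have := hK.anti (a := z - y) (b := -ρ) (by linarith) hy
          rw [hk₄, hq] at this
          exact_mod_cast this
        linarith
      · have h2 : u ≤ q := by
          have := hK.anti (a := z - y) (b := t - y) (by linarith) (by linarith)
          rw [hu, hq] at this
          exact_mod_cast this
        have h3 : k₁ ≤ k := by
          have := hK.mono (a := 1) (b := t) zero_le_one (by linarith)
          rw [hk₁, hk] at this
          exact_mod_cast this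
        linarith
    · have h2 : k₃ + u ≤ q + k' := by
        have := (hK.add_le_add_of_nonneg (a := ρ) (b := z - y) (c := t - z + ρ) (d := t - y)
          hρ.le hy (by linarith) (by ring)).trans
          (add_le_add le_rfl (hK.mono (b := t + h) (by linarith) (by linarith)))
        rw [hk₃, hu, hq, hk'] at this
        exact_mod_cast this
      linarith

lemma exists_eventually_cocompact_sub_le (hK : MonotoneKernel K) (z : ℝ) {ρ : ℝ} (hρ : 0 < ρ) :
    ∃ C : ℝ, ∀ᶠ t in cocompact ℝ, ∀ y, ρ ≤ |z - y| → K (t - y) ≤ K (z - y) + (K t + C) := by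
  obtain ⟨C, hC⟩ := hK.exists_eventually_atTop_sub_le z hρ
  obtain ⟨D, hD⟩ := hK.reflect.exists_eventually_atTop_sub_le (-z) hρ
  have hle : ∀ t B, B ≤ max C D → K t + (B : EReal) ≤ K t + ((max C D : ℝ) : EReal) :=
    fun t B h => add_le_add le_rfl (by exact_mod_cast h)
  refine ⟨max C D, ?_⟩
  rw [cocompact_eq_atBot_atTop, eventually_sup]
  constructor
  · filter_upwards [tendsto_neg_atBot_atTop.eventually hD] with t ht y hy
    have := ht (-y) (by rwa [← abs_neg, show -(-z - -y) = z - y by ring])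
    rw [show -(-t - -y) = t - y by ring, show -(-z - -y) = z - y by ring, neg_neg] at this
    exact this.trans (add_le_add le_rfl (hle t D (le_max_right _ _)))
  · filter_upwards [hC] with t ht y hy
    exact (ht y hy).trans (add_le_add le_rfl (hle t C (le_max_left _ _)))

end MonotoneKernel

lemma eventually_sumTrans_le (hK : MonotoneKernel K) (hr : ∀ j, 0 < r j)
    (hadm : IsAdmissible K J (∑ j, r j)) {z : ℝ} (hz : J z ≠ ⊥) {ρ : ℝ} (hρ : 0 < ρ) :
    ∀ᶠ t in cocompact ℝ, ∀ y : Fin n → ℝ, (∀ j, ρ ≤ |z - y j|) →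
      SumTrans K J r y t ≤ SumTrans K J r y z := by
  obtain ⟨C, hC⟩ := hK.exists_eventually_cocompact_sub_le z hρ
  obtain ⟨a, -, ha⟩ := EReal.lt_iff_exists_real_btwn.1 (bot_lt_iff_ne_bot.2 hz)
  filter_upwards [hC, hadm.eventually_lt_const (EReal.bot_lt_coe (a - (∑ j, r j) * C)),
    (isCompact_singleton (x := (0 : ℝ))).compl_mem_cocompact] with t ht hlt ht0 y hy
  obtain ⟨k, hk⟩ : ∃ k : ℝ, K t = k := ⟨_, (hK.coe_toReal ht0).symm⟩
  rw [hk] at hlt ht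
  have hsum : translateSum K r y t ≤
      translateSum K r y z + (((∑ j, r j) * (k + C) : ℝ) : EReal) := by
    have : (((∑ j, r j) * (k + C) : ℝ) : EReal) = ∑ j, (r j : EReal) * (k + C : ℝ) := by
      rw [Finset.sum_mul]
      exact map_sum (⟨⟨Real.toEReal, EReal.coe_zero⟩, EReal.coe_add⟩ : ℝ →+ EReal) _ _
    rw [this]
    unfold translateSum
    rw [← Finset.sum_add_distrib]
    refine Finset.sum_le_sum fun j _ => ?_
    have h0 : (0 : EReal) ≤ r j := by exact_mod_cast (hr j).le
    rw [← EReal.left_distrib_of_nonneg_of_ne_top h0 (EReal.coe_ne_top _)]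
    refine mul_le_mul_of_nonneg_left ?_ h0
    simpa using ht (y j) (hy j)
  have hJ : J t + (((∑ j, r j) * (k + C) : ℝ) : EReal) ≤ a := by
    induction hu : J t with
    | bot => simp
    | top => simp [hu, ← EReal.coe_mul] at hlt
    | coe u =>
      rw [hu] at hlt
      norm_cast at hlt ⊢
      linarith
  calc SumTrans K J r y t = J t + translateSum K r y t := rfl
    _ ≤ J t + (translateSum K r y z + (((∑ j, r j) * (k + C) : ℝ) : EReal)) :=
      add_le_add le_rfl hsum
    _ = J t + (((∑ j, r j) * (k + C) : ℝ) : EReal) + translateSum K r y z := by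
      rw [add_assoc, add_comm (translateSum K r y z)]
    _ ≤ J z + translateSum K r y z := add_le_add (hJ.trans ha.le) le_rfl

/-- More than `n` points cannot all be close to one of `n` nodes. -/
lemma exists_forall_exists_forall_le_abs_sub {S : Finset ℝ} (hS : n < S.card) :
    ∃ ρ > 0, ∀ y : Fin n → ℝ, ∃ z ∈ S, ∀ j, ρ ≤ |z - y j| := by
  have hev : ∀ᶠ ρ in 𝓝[>] (0 : ℝ), ∀ p ∈ S.offDiag, 2 * ρ < |p.1 - p.2| := by
    refine (Filter.eventually_all_finset _).2 fun p hp => ?_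
    have h0 : 0 < |p.1 - p.2| := abs_pos.2 (sub_ne_zero.2 (Finset.mem_offDiag.1 hp).2.2)
    filter_upwards [Ioo_mem_nhdsGT (half_pos h0)] with ρ hρ
    linarith [hρ.2]
  obtain ⟨ρ, hρ, hρ0⟩ := (hev.and self_mem_nhdsWithin).exists
  refine ⟨ρ, hρ0, fun y => ?_⟩
  by_contra! h
  have hne : Nonempty (Fin n) := by
    obtain ⟨z, hz⟩ := Finset.card_pos.1 (Nat.zero_lt_of_lt hS)
    exact (h z hz).nonempty
  choose! f hf using h
  obtain ⟨x, hx, z, hz, hxz, he⟩ := Finset.exists_ne_map_eq_of_card_lt_of_maps_to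
    (s := S) (t := Finset.univ) (f := f) (by simpa using hS) fun _ _ => Finset.mem_univ _
  have h1 := hρ (x, z) (Finset.mem_offDiag.2 ⟨hx, hz, hxz⟩)
  have h2 := hf x hx
  have h3 := hf z hz
  rw [← he, abs_sub_comm] at h3
  have h4 := abs_sub_le x (y (f x)) z
  dsimp only at h1
  linarith

/-- All sums of translates are controlled by their values on a common segment. -/
lemma exists_forall_sumTrans_le (hK : MonotoneKernel K) (hr : ∀ j, 0 < r j)
    (hJ : IsFieldFn n J) (hadm : IsAdmissible K J (∑ j, r j)) :
    ∃ b > 0, ∀ (y : Fin n → ℝ) (t : ℝ), ∃ z ∈ Icc (-b) b,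
      SumTrans K J r y t ≤ SumTrans K J r y z := by
  obtain ⟨S, hcard, hS⟩ := hJ.2
  obtain ⟨ρ, hρ, hsep⟩ := exists_forall_exists_forall_le_abs_sub hcard
  obtain ⟨k, hk, hkt⟩ := mem_cocompact.1 ((Filter.eventually_all_finset S).2 fun z hz =>
    eventually_sumTrans_le hK hr hadm (hS z hz) hρ)
  obtain ⟨b, hb, hsub⟩ :=
    (hk.union S.finite_toSet.isCompact).isBounded.subset_closedBall_lt 0 0
  rw [Real.closedBall_eq_Icc, zero_sub, zero_add] at hsub
  refine ⟨b, hb, fun y t => ?_⟩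
  by_cases ht : t ∈ k
  · exact ⟨t, hsub (.inl ht), le_rfl⟩
  · obtain ⟨z, hz, hzy⟩ := hsep y
    exact ⟨z, hsub (.inr hz), hkt ht z hz y hzy⟩

end Localization

/-- `M(S^∞) = m(S^∞)`, i.e.
`inf_{y ∈ S^∞} max_j mⱼ(y) = sup_{y ∈ S^∞} min_j mⱼ(y)`. -/
theorem minimax_eq_maximin (K J : ℝ → EReal) (hK : MonotoneKernel K)
    (n : ℕ) (hn : 0 < n) (r : Fin n → ℝ) (hr : ∀ j, 0 < r j)
    (hJ : IsFieldFn n J) (hadm : IsAdmissible K J (∑ j, r j)) :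
    sInf ((fun y : Fin n → ℝ => ⨆ j : Fin (n + 1), mloc K J r y j) ''
        {y | Monotone y}) =
      sSup ((fun y : Fin n → ℝ => ⨅ j : Fin (n + 1), mloc K J r y j) ''
        {y | Monotone y}) := by
  obtain ⟨b, hb, hloc⟩ := exists_forall_sumTrans_le hK hr hJ hadm
  obtain ⟨c, hc⟩ := hJ.1
  set φ := upperEnvelope J (Icc (-b) b)
  obtain ⟨w, hw, heq⟩ := exists_forall_mloc_eq (φ := φ) hK hr
    (upperSemicontinuous_upperEnvelope J _)
    (fun t => ((upperEnvelope_le hc).trans_lt (EReal.coe_lt_top c)).ne)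
    (b := b + 1) (by linarith) fun t ht =>
      upperEnvelope_eq_bot isClosed_Icc fun h => ht ⟨by linarith [h.1], by linarith [h.2]⟩
  refine le_antisymm ?_ ?_
  · trans mloc K φ r w 0
    · refine (sInf_le (mem_image_of_mem _ hw)).trans (iSup_le fun i => mloc_le_iff.2 fun t _ => ?_)
      obtain ⟨z, hz, htz⟩ := hloc w t
      obtain ⟨k, hk⟩ := exists_mem_cell hw z
      rw [← heq k]
      exact (htz.trans (add_le_add (le_upperEnvelope hz) le_rfl)).trans (sumTrans_le_mloc hk)
    · refine le_of_forall_lt_imp_le_of_dense fun a ha => ?_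
      obtain ⟨z, hz, haz⟩ := exists_forall_lt_mloc hK hr hw fun i => (heq i).symm ▸ ha
      exact (le_iInf fun i => (haz i).le).trans (le_sSup (mem_image_of_mem _ hz))
  · refine sSup_le ?_
    rintro _ ⟨x, -, rfl⟩
    refine le_sInf ?_
    rintro _ ⟨y, hy, rfl⟩
    obtain ⟨i, hi⟩ := exists_mloc_le_mloc hK J hr x hy
    exact (iInf_le _ i).trans (hi.trans (le_iSup (mloc K J r y) i))
end
end

section
/- Let K be a monotone kernel function, n ∈ ℕ, r₁,…,rₙ > 0 with R := r₁ + … + rₙ, and let J be an n-field function on ℝ that is R-admissible for K. Then there do not exist x, y ∈ S^∞ with all local maxima mⱼ(x), mⱼ(y) (j = 0,…,n) finite such that mⱼ(x) > mⱼ(y) for every j = 0,…,n. -/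
open Filter Set Topology

noncomputable section

theorem ConcaveOn.exists_sub_le_mul_sub {S : Set ℝ} {f : ℝ → ℝ} (hf : ConcaveOn ℝ S f) {q : ℝ}
    (hq : q ∈ interior S) : ∃ a : ℝ, ∀ p ∈ S, f p - f q ≤ a * (p - q) := by
  have hg := hf.neg
  refine ⟨-derivWithin (-f) (Ioi q) q, fun p hp => ?_⟩
  rcases lt_trichotomy p q with h | rfl | h
  · have h1 := (hg.slope_le_leftDeriv_of_mem_interior hp hq h).trans
      (hg.leftDeriv_le_rightDeriv_of_mem_interior hq)
    rw [slope_def_field, div_le_iff₀ (sub_pos.2 h)] at h1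
    simp only [Pi.neg_apply] at h1
    linarith
  · simp
  · have h1 := hg.rightDeriv_le_slope_of_mem_interior hq hp h
    rw [slope_def_field, le_div_iff₀ (sub_pos.2 h)] at h1
    simp only [Pi.neg_apply] at h1
    linarith

theorem exists_antitoneOn_supergradient {f : ℝ → ℝ} (hf : ConcaveOn ℝ (Ioi 0) f)
    (hmono : MonotoneOn f (Ioi 0)) :
    ∃ a : ℝ → ℝ, (∀ q, 0 < q → 0 ≤ a q) ∧ AntitoneOn a (Ioi 0) ∧
      ∀ p q, 0 < p → 0 < q → f p - f q ≤ a q * (p - q) := by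
  have h : ∀ q : ℝ, ∃ a : ℝ, 0 < q → ∀ p ∈ Ioi (0 : ℝ), f p - f q ≤ a * (p - q) := by
    intro q
    by_cases hq : 0 < q
    · obtain ⟨a, ha⟩ := hf.exists_sub_le_mul_sub (q := q) (by rwa [interior_Ioi])
      exact ⟨a, fun _ => ha⟩
    · exact ⟨0, fun h => absurd h hq⟩
  choose a ha using h
  refine ⟨a, fun q hq => ?_, fun p hp q hq hpq => ?_, fun p q hp hq => ha q hq p hp⟩
  · have h1 := ha q hq (q + 1) (mem_Ioi.2 (by linarith))
    have h2 := hmono hq (mem_Ioi.2 (by linarith : 0 < q + 1)) (by linarith)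
    linarith
  · rcases hpq.eq_or_lt with rfl | hlt
    · exact le_rfl
    · have h1 := ha q hq p hp
      have h2 := ha p hp q hq
      nlinarith

/-- Summation by parts: if the partial sums `T` of `c` are minimal, with value `0`, at the index
`j`, and `μ` is nonpositive antitone before `j` and nonnegative antitone from `j` on,
then `∑ μ i * c i` is nonnegative. -/
theorem sum_range_mul_nonneg {n : ℕ} (μ c T : ℕ → ℝ) (j : ℕ) (hT : ∀ k ≤ n, 0 ≤ T k)
    (hstep : ∀ i < n, T (i + 1) - T i = c i) (hTj : T j = 0) (hjn : j ≤ n)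
    (hanti : ∀ k, k + 1 < n → k + 1 ≠ j → μ (k + 1) ≤ μ k)
    (hneg : ∀ i < n, i < j → μ i ≤ 0) (hpos : ∀ i < n, j ≤ i → 0 ≤ μ i) :
    0 ≤ ∑ i ∈ Finset.range n, μ i * c i := by
  have key : ∀ k < n, μ k * T (k + 1) ≤ ∑ i ∈ Finset.range (k + 1), μ i * c i := by
    intro k
    induction k with
    | zero =>
      intro hn
      rw [Finset.sum_range_one, ← hstep 0 hn]
      rcases Nat.eq_zero_or_pos j with rfl | hj
      · rw [hTj]; simp
      · nlinarith [mul_nonneg (neg_nonneg.2 (hneg 0 hn hj)) (hT 0 hn.le)]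
    | succ k ih =>
      intro hk
      rw [Finset.sum_range_succ, ← hstep (k + 1) hk]
      have h1 := ih (by omega)
      by_cases hj : k + 1 = j
      · rw [hj, hTj] at h1 ⊢
        linarith
      · nlinarith [mul_nonneg (sub_nonneg.2 (hanti k hk hj)) (hT (k + 1) hk.le)]
  rcases n with _ | m
  · simp
  · refine le_trans ?_ (key m (by omega))
    rcases hjn.eq_or_lt with rfl | hj
    · rw [hTj]; simp
    · exact mul_nonneg (hpos m (by omega) (by omega)) (hT _ le_rfl)

theorem MonotoneKernel.comp_neg {K : ℝ → EReal} (hK : MonotoneKernel K) :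
    MonotoneKernel fun t => K (-t) := by
  obtain ⟨⟨hfin, hl, hr, h0, htl, htr⟩, hanti, hmono⟩ := hK
  have hneg : ∀ a b s t : ℝ, a * -s + b * -t = -(a * s + b * t) := by intros; ring
  refine ⟨⟨fun t ht => hfin _ (neg_ne_zero.2 ht), ⟨convex_Iio 0, ?_⟩, ⟨convex_Ioi 0, ?_⟩,
    by simpa using h0, ?_, ?_⟩, ?_, ?_⟩
  · intro s hs t ht a b ha hb hab
    have := hr.2 (x := -s) (by simpa using hs) (y := -t) (by simpa using ht) ha hb hab
    simpa only [smul_eq_mul, hneg] using this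
  · intro s hs t ht a b ha hb hab
    have := hl.2 (x := -s) (by simpa using hs) (y := -t) (by simpa using ht) ha hb hab
    simpa only [smul_eq_mul, hneg] using this
  · have : Tendsto (fun t : ℝ => -t) (𝓝[<] 0) (𝓝[>] 0) := by
      simpa using tendsto_neg_nhdsLT (a := (0 : ℝ))
    simpa [Function.comp_def] using htr.comp this
  · have : Tendsto (fun t : ℝ => -t) (𝓝[>] 0) (𝓝[<] 0) := by
      simpa using tendsto_neg_nhdsGT (a := (0 : ℝ))
    simpa [Function.comp_def] using htl.comp this
  · intro s hs t ht hst
    exact hmono (by simpa using ht) (by simpa using hs) (neg_le_neg hst)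
  · intro s hs t ht hst
    exact hanti (by simpa using ht) (by simpa using hs) (neg_le_neg hst)

theorem MonotoneKernel.monotoneOn_toReal {K : ℝ → EReal} (hK : MonotoneKernel K) :
    MonotoneOn (fun t => (K t).toReal) (Ioi 0) := fun s hs t ht hst =>
  EReal.toReal_le_toReal (hK.2.2 hs ht hst) (hK.1.1 s (ne_of_gt hs)).1 (hK.1.1 t (ne_of_gt ht)).2

theorem IsKernel.tendsto_add_right {K : ℝ → EReal} (hK : IsKernel K) {d : ℝ} (hd : 0 ≤ d) :
    Tendsto (fun ε => K (d + ε)) (𝓝[>] 0) (𝓝 (K d)) := by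
  obtain ⟨hfin, -, hr, -, -, htr⟩ := hK
  rcases hd.eq_or_lt with rfl | hd
  · simpa using htr
  · have hc : ContinuousAt (fun t => (K t).toReal) d :=
      (hr.continuousOn isOpen_Ioi).continuousAt (Ioi_mem_nhds hd)
    have hlim : Tendsto (fun ε : ℝ => d + ε) (𝓝[>] 0) (𝓝 d) := by
      have : Tendsto (fun ε : ℝ => d + ε) (𝓝 0) (𝓝 (d + 0)) := tendsto_const_nhds.add tendsto_id
      exact (by simpa using this : Tendsto _ _ _).mono_left nhdsWithin_le_nhds
    have h1 := (continuous_coe_real_ereal.tendsto _).comp (hc.tendsto.comp hlim)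
    rw [EReal.coe_toReal (hfin d hd.ne').2 (hfin d hd.ne').1] at h1
    refine h1.congr' ?_
    filter_upwards [self_mem_nhdsWithin] with ε hε
    have hne : d + ε ≠ 0 := (add_pos hd hε).ne'
    exact EReal.coe_toReal (hfin _ hne).2 (hfin _ hne).1

theorem IsKernel.ne_top {K : ℝ → EReal} (hK : IsKernel K) (t : ℝ) : K t ≠ ⊤ := by
  by_cases ht : t = 0
  · exact ht ▸ hK.2.2.2.1
  · exact (hK.1 t ht).2

theorem EReal.coe_mul_ne_top {r : ℝ} (hr : 0 < r) {a : EReal} (ha : a ≠ ⊤) :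
    (r : EReal) * a ≠ ⊤ := by
  induction a with
  | bot => simp [EReal.coe_mul_bot_of_pos hr]
  | coe a => exact_mod_cast EReal.coe_ne_top (r * a)
  | top => exact absurd rfl ha

theorem EReal.sum_ne_top {ι : Type*} {s : Finset ι} {f : ι → EReal} (hf : ∀ i, f i ≠ ⊤) :
    ∑ i ∈ s, f i ≠ ⊤ := by
  classical
  induction s using Finset.induction_on with
  | empty => simp
  | insert i s hi ih => rw [Finset.sum_insert hi]; exact EReal.add_ne_top (hf i) ih

theorem EReal.tendsto_finset_sum {ι α : Type*} {l : Filter α} {s : Finset ι}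
    {f : ι → α → EReal} {a : ι → EReal} (ha : ∀ i, a i ≠ ⊤)
    (h : ∀ i, Tendsto (f i) l (𝓝 (a i))) :
    Tendsto (fun x => ∑ i ∈ s, f i x) l (𝓝 (∑ i ∈ s, a i)) := by
  classical
  induction s using Finset.induction_on with
  | empty => simpa using tendsto_const_nhds
  | insert i s hi ih =>
    simp only [Finset.sum_insert hi]
    exact (EReal.continuousAt_add (p := (a i, ∑ i ∈ s, a i)) (.inl (ha i))
      (.inr (EReal.sum_ne_top ha))).tendsto.comp ((h i).prodMk_nhds ih)

theorem EReal.coe_finset_sum {ι : Type*} (s : Finset ι) (f : ι → ℝ) :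
    ((∑ i ∈ s, f i : ℝ) : EReal) = ∑ i ∈ s, (f i : EReal) := by
  classical
  induction s using Finset.induction_on with
  | empty => simp
  | insert i s hi ih => rw [Finset.sum_insert hi, Finset.sum_insert hi, EReal.coe_add, ih]

/-- The comparison of pure sums of translates at a common point `t` of the `j`-th cells of `x`
and `y`, after pushing all nodes away from `t` by `ε`. -/
theorem MonotoneKernel.sum_toReal_le {K : ℝ → EReal} (hK : MonotoneKernel K) {n : ℕ}
    {r x y : Fin n → ℝ} (hr : ∀ i, 0 < r i) (hy : Monotone y) {T : ℕ → ℝ} {j : Fin (n + 1)}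
    (hT : ∀ k ≤ n, 0 ≤ T k) (hstep : ∀ i : Fin n, T (i + 1) - T i = r i * (y i - x i))
    (hTj : T j = 0) {t ε : ℝ} (htx : t ∈ cell x j) (hty : t ∈ cell y j) (hε : 0 < ε) :
    ∑ i, r i * (K (t - x i + if (i : ℕ) < j then ε else -ε)).toReal ≤
      ∑ i, r i * (K (t - y i + if (i : ℕ) < j then ε else -ε)).toReal := by
  obtain ⟨a, ha0, haa, ha⟩ :=
    exists_antitoneOn_supergradient hK.1.2.2.1 hK.monotoneOn_toReal
  obtain ⟨b, hb0, hba, hb⟩ :=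
    exists_antitoneOn_supergradient hK.comp_neg.1.2.2.1 hK.comp_neg.monotoneOn_toReal
  have hxl : ∀ i : Fin n, (i : ℕ) < j → 0 < t - x i + ε := fun i hi => by
    linarith [htx.1 i hi]
  have hyl : ∀ i : Fin n, (i : ℕ) < j → 0 < t - y i + ε := fun i hi => by
    linarith [hty.1 i hi]
  have hxr : ∀ i : Fin n, (j : ℕ) ≤ i → 0 < x i - t + ε := fun i hi => by
    linarith [htx.2 i hi]
  have hyr : ∀ i : Fin n, (j : ℕ) ≤ i → 0 < y i - t + ε := fun i hi => by
    linarith [hty.2 i hi]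
  set μ : Fin n → ℝ := fun i =>
    if (i : ℕ) < j then -a (t - y i + ε) else b (y i - t + ε) with hμ
  have hterm : ∀ i, μ i * (r i * (y i - x i)) ≤
      r i * (K (t - y i + if (i : ℕ) < j then ε else -ε)).toReal -
        r i * (K (t - x i + if (i : ℕ) < j then ε else -ε)).toReal := by
    intro i
    by_cases hi : (i : ℕ) < j
    · simp only [hμ, if_pos hi]
      nlinarith [mul_le_mul_of_nonneg_left (ha _ _ (hxl i hi) (hyl i hi)) (hr i).le]
    · have h := mul_le_mul_of_nonneg_left
        (hb _ _ (hxr i (not_lt.1 hi)) (hyr i (not_lt.1 hi))) (hr i).le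
      simp only [hμ, if_neg hi]
      beta_reduce at h
      rw [show -(x i - t + ε) = t - x i + -ε by ring,
        show -(y i - t + ε) = t - y i + -ε by ring] at h
      nlinarith
  have hsum : 0 ≤ ∑ i, μ i * (r i * (y i - x i)) := by
    have h := sum_range_mul_nonneg (n := n) (fun k => if h : k < n then μ ⟨k, h⟩ else 0)
      (fun k => if h : k < n then r ⟨k, h⟩ * (y ⟨k, h⟩ - x ⟨k, h⟩) else 0) T j hT
      (fun k hk => by simpa only [dif_pos hk] using hstep ⟨k, hk⟩) hTj (by omega)
      ?_ ?_ ?_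
    · rw [Finset.sum_range] at h
      simpa using h
    · intro k hk hkj
      have hk' : k < n := by omega
      have hyk : y ⟨k, hk'⟩ ≤ y ⟨k + 1, hk⟩ := hy (Fin.mk_le_mk.2 (by omega))
      simp only [dif_pos hk, dif_pos hk', hμ]
      rcases lt_or_ge (k + 1) (j : ℕ) with hj | hj
      · rw [if_pos hj, if_pos (by omega)]
        exact neg_le_neg (haa (hyl ⟨k + 1, hk⟩ hj)
          (hyl ⟨k, hk'⟩ (show k < (j : ℕ) by omega)) (by linarith))
      · rw [if_neg (by omega), if_neg (by omega)]
        exact hba (hyr ⟨k, hk'⟩ (show (j : ℕ) ≤ k by omega)) (hyr ⟨k + 1, hk⟩ hj) (by linarith)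
    · intro k hk hkj
      simp only [dif_pos hk, hμ, if_pos hkj]
      exact neg_nonpos.2 (ha0 _ (hyl ⟨k, hk⟩ hkj))
    · intro k hk hkj
      simp only [dif_pos hk, hμ, if_neg (not_lt.2 hkj)]
      exact hb0 _ (hyr ⟨k, hk⟩ hkj)
  have := hsum.trans (Finset.sum_le_sum fun i _ => hterm i)
  rw [Finset.sum_sub_distrib] at this
  linarith

theorem MonotoneKernel.tendsto_sum_translates {K : ℝ → EReal} (hK : MonotoneKernel K) {n : ℕ}
    {r z : Fin n → ℝ} (hr : ∀ i, 0 < r i) {j : Fin (n + 1)} {t : ℝ} (ht : t ∈ cell z j) :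
    Tendsto (fun ε : ℝ =>
        ((∑ i, r i * (K (t - z i + if (i : ℕ) < j then ε else -ε)).toReal : ℝ) : EReal))
      (𝓝[>] 0) (𝓝 (∑ i, (r i : EReal) * K (t - z i))) := by
  have hlim : Tendsto (fun ε : ℝ =>
      ∑ i, (r i : EReal) * K (t - z i + if (i : ℕ) < j then ε else -ε))
      (𝓝[>] 0) (𝓝 (∑ i, (r i : EReal) * K (t - z i))) := by
    refine EReal.tendsto_finset_sum (fun i => EReal.coe_mul_ne_top (hr i) (hK.1.ne_top _))
      fun i => ?_
    have h : Tendsto (fun ε : ℝ => K (t - z i + if (i : ℕ) < j then ε else -ε)) (𝓝[>] 0)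
        (𝓝 (K (t - z i))) := by
      by_cases hi : (i : ℕ) < j
      · simpa only [if_pos hi] using hK.1.tendsto_add_right (sub_nonneg.2 (ht.1 i hi))
      · have h := hK.comp_neg.1.tendsto_add_right (sub_nonneg.2 (ht.2 i (not_lt.1 hi)))
        simpa only [if_neg hi, neg_add, neg_sub] using h
    have hri : ((r i : ℝ) : EReal) ≠ 0 := by exact_mod_cast (hr i).ne'
    exact (EReal.continuousAt_mul (p := ((r i : EReal), K (t - z i))) (.inl hri) (.inl hri)
      (.inl (EReal.coe_ne_bot _)) (.inl (EReal.coe_ne_top _))).tendsto.comp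
        (tendsto_const_nhds.prodMk_nhds h)
  refine hlim.congr' ?_
  filter_upwards [self_mem_nhdsWithin] with ε hε
  rw [EReal.coe_finset_sum]
  refine Finset.sum_congr rfl fun i _ => ?_
  have hne : (t - z i + if (i : ℕ) < j then ε else -ε) ≠ 0 := by
    have hε' : 0 < ε := hε
    split_ifs with hi
    · exact ne_of_gt (by linarith [ht.1 i hi])
    · exact ne_of_lt (by linarith [ht.2 i (not_lt.1 hi)])
  rw [EReal.coe_mul, EReal.coe_toReal (hK.1.1 _ hne).2 (hK.1.1 _ hne).1]

/-- Some cell of `x` is contained in the corresponding cell of `y`, with larger sums of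
translates for `y`: it is the one at which the partial sums of `r i * (y i - x i)` are minimal. -/
theorem MonotoneKernel.exists_mloc_le {K : ℝ → EReal} (hK : MonotoneKernel K) (J : ℝ → EReal)
    {n : ℕ} {r x y : Fin n → ℝ} (hr : ∀ i, 0 < r i) (hy : Monotone y) :
    ∃ j, mloc K J r x j ≤ mloc K J r y j := by
  set S : ℕ → ℝ := fun k => ∑ i : Fin n, if (i : ℕ) < k then r i * (y i - x i) else 0 with hS
  have hstep : ∀ i : Fin n, S (i + 1) - S i = r i * (y i - x i) := by
    intro i
    simp only [hS, ← Finset.sum_sub_distrib]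
    rw [Finset.sum_eq_single i]
    · simp
    · intro k _ hk
      have hk' : (k : ℕ) ≠ i := fun h => hk (Fin.ext h)
      by_cases h : (k : ℕ) < i
      · rw [if_pos h, if_pos (by omega), sub_self]
      · rw [if_neg h, if_neg (by omega), sub_self]
    · simp
  obtain ⟨j, -, hj⟩ := Finset.exists_min_image (Finset.univ : Finset (Fin (n + 1)))
    (fun k => S k) Finset.univ_nonempty
  have hmin : ∀ k ≤ n, S j ≤ S k := fun k hk => hj ⟨k, by omega⟩ (Finset.mem_univ _)
  have hcell : cell x j ⊆ cell y j := by
    intro t ht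
    constructor
    · intro i hi
      let l : Fin n := ⟨(j : ℕ) - 1, by omega⟩
      have hl : (l : ℕ) + 1 = j := by simp only [l]; omega
      have h := hstep l
      rw [hl] at h
      have h' : r l * (y l - x l) ≤ 0 := by linarith [hmin l l.2.le]
      have hyx : y l ≤ x l := by nlinarith [hr l]
      exact ((hy (Fin.le_def.2 (by omega))).trans hyx).trans (ht.1 l (by omega))
    · intro i hi
      let l : Fin n := ⟨j, by omega⟩
      have hl : (l : ℕ) = j := rfl
      have h := hstep l
      rw [hl] at h
      have h' : 0 ≤ r l * (y l - x l) := by linarith [hmin (j + 1) (by omega)]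
      have hxy : x l ≤ y l := by nlinarith [hr l]
      exact ((ht.2 l le_rfl).trans hxy).trans (hy (Fin.le_def.2 hi))
  refine ⟨j, sSup_le ?_⟩
  rintro _ ⟨t, ht, rfl⟩
  refine le_trans ?_ (le_sSup ⟨t, hcell ht, rfl⟩)
  refine add_le_add le_rfl (le_of_tendsto_of_tendsto (hK.tendsto_sum_translates hr ht)
    (hK.tendsto_sum_translates hr (hcell ht)) ?_)
  filter_upwards [self_mem_nhdsWithin] with ε hε
  exact EReal.coe_le_coe_iff.2 (hK.sum_toReal_le hr hy (T := fun k => S k - S j)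
    (fun k hk => sub_nonneg.2 (hmin k hk)) (fun i => by linarith [hstep i]) (sub_self _)
    ht (hcell ht) hε)

/-- there are no `x, y ∈ S^∞` with all local maxima finite such that
`mⱼ(x) > mⱼ(y)` for every `j = 0, …, n`. -/
theorem no_strict_majorization (K J : ℝ → EReal) (hK : MonotoneKernel K)
    (n : ℕ) (hn : 0 < n) (r : Fin n → ℝ) (hr : ∀ j, 0 < r j)
    (hJ : IsFieldFn n J) (hadm : IsAdmissible K J (∑ j, r j)) :
    ¬ ∃ x y : Fin n → ℝ, Monotone x ∧ Monotone y ∧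
      (∀ j : Fin (n + 1), mloc K J r x j ≠ ⊥ ∧ mloc K J r x j ≠ ⊤) ∧
      (∀ j : Fin (n + 1), mloc K J r y j ≠ ⊥ ∧ mloc K J r y j ≠ ⊤) ∧
      (∀ j : Fin (n + 1), mloc K J r y j < mloc K J r x j) := by
  rintro ⟨x, y, -, hy, -, -, hlt⟩
  obtain ⟨j, hj⟩ := hK.exists_mloc_le J hr (x := x) hy
  exact absurd (hlt j) hj.not_gt
end
end
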